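/- arXiv:2202.10920 — 4 statements merged into one kernel-verified Lean document; each statement's English description precedes it below -/
import Mathlib

section
/- Let z ∈ H²(A) be a nonzero element with z² = 0 in the Bott ring R_A. Then there exist an index i ∈ {1,…,n} and a nonzero rational number λ such that α_i² = 0 in R_A and z = λ(2x_i − α_i) in H²(A) ⊗ ℚ. -/
open MvPolynomial

namespace Bott

/-- A square integer matrix indexed by `Fin n` (rows, columns).  We think of it as the
matrix `A = (a_{ij})` defining a Bott tower; strict lower triangularity is the
predicate `SLT` below. -/
abbrev Mat (n : ℕ) := Fin n → Fin n → ℤ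

/-- `a` is strictly lower triangular: `a i j = 0` unless `j < i`. -/
def SLT {n : ℕ} (a : Mat n) : Prop := ∀ i j : Fin n, a i j ≠ 0 → (j : ℕ) < (i : ℕ)

section Defs

variable (n : ℕ)

/-- The linear form `α_i = ∑_{j<i} a_{ij} x_j` (the terms with `j ≥ i` vanish for a
strictly lower triangular matrix). -/
noncomputable def alpha (a : Mat n) (i : Fin n) : MvPolynomial (Fin n) ℤ :=
  ∑ j, C (a i j) * X j

/-- The ideal `(x_i² − α_i x_i : 1 ≤ i ≤ n)`. -/
noncomputable def bottIdeal (a : Mat n) : Ideal (MvPolynomial (Fin n) ℤ) :=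
  Ideal.span (Set.range fun i : Fin n => X i ^ 2 - alpha n a i * X i)

/-- The Bott ring `R_A = ℤ[x_1,…,x_n]/(x_i² − α_i x_i)`. -/
abbrev BRing (a : Mat n) := MvPolynomial (Fin n) ℤ ⧸ bottIdeal n a

/-- Quotient projection onto the Bott ring. -/
noncomputable def bmk (a : Mat n) : MvPolynomial (Fin n) ℤ →+* BRing n a :=
  Ideal.Quotient.mk _

/-- The class `x_i` in the Bott ring (0-based: `bx a i` is the paper's `x_{i+1}`). -/
noncomputable def bx (a : Mat n) (i : Fin n) : BRing n a := bmk n a (X i)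

/-- The class of `α_i` in the Bott ring. -/
noncomputable def bal (a : Mat n) (i : Fin n) : BRing n a := bmk n a (alpha n a i)

/-- `F_k(A)`: the span of the first `k` degree-2 generators (paper's `x_1, …, x_k`,
0-based indices `< k`). -/
noncomputable def F (a : Mat n) (k : ℕ) : Submodule ℤ (BRing n a) :=
  Submodule.span ℤ (bx n a '' {i : Fin n | (i : ℕ) < k})

/-- `H²(A)`: the span of all the degree-2 generators. -/
noncomputable def H2 (a : Mat n) : Submodule ℤ (BRing n a) :=
  Submodule.span ℤ (Set.range (bx n a))

/-- `ht(η) = min {k | η ∈ F_k(A)}`. -/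
noncomputable def ht (a : Mat n) (η : BRing n a) : ℕ := sInf {k | η ∈ F n a k}

/-- A ring isomorphism between Bott rings is graded iff it preserves the degree-2
components in both directions (both rings are generated in degree 2, so this is
equivalent to preserving the whole grading). -/
def IsGraded (a b : Mat n) (φ : BRing n a ≃+* BRing n b) : Prop :=
  (∀ z ∈ H2 n a, φ z ∈ H2 n b) ∧ (∀ z ∈ H2 n b, φ.symm z ∈ H2 n a)

/-- `φ` is `k`-stable: `φ(F_k(A)) ⊆ F_k(B)`. -/
def IsStable (a b : Mat n) (k : ℕ) (φ : BRing n a ≃+* BRing n b) : Prop :=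
  ∀ z ∈ F n a k, φ z ∈ F n b k

/-! ### Rationalizations -/

/-- The linear form `α_i` with rational coefficients. -/
noncomputable def alphaQ (a : Mat n) (i : Fin n) : MvPolynomial (Fin n) ℚ :=
  ∑ j, C ((a i j : ℚ)) * X j

noncomputable def bottIdealQ (a : Mat n) : Ideal (MvPolynomial (Fin n) ℚ) :=
  Ideal.span (Set.range fun i : Fin n => X i ^ 2 - alphaQ n a i * X i)

/-- The rationalized Bott ring `R_A ⊗ ℚ`. -/
abbrev BRingQ (a : Mat n) := MvPolynomial (Fin n) ℚ ⧸ bottIdealQ n a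

noncomputable def bmkQ (a : Mat n) : MvPolynomial (Fin n) ℚ →+* BRingQ n a :=
  Ideal.Quotient.mk _

noncomputable def bxQ (a : Mat n) (i : Fin n) : BRingQ n a := bmkQ n a (X i)

noncomputable def balQ (a : Mat n) (i : Fin n) : BRingQ n a := bmkQ n a (alphaQ n a i)

/-- `F_k(A) ⊗ ℚ` inside `R_A ⊗ ℚ`. -/
noncomputable def FQ (a : Mat n) (k : ℕ) : Submodule ℚ (BRingQ n a) :=
  Submodule.span ℚ (bxQ n a '' {i : Fin n | (i : ℕ) < k})

/-- The canonical map `R_A → R_A ⊗ ℚ`. -/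
noncomputable def toQ (a : Mat n) : BRing n a →+* BRingQ n a :=
  Ideal.Quotient.lift (bottIdeal n a)
    ((bmkQ n a).comp (MvPolynomial.map (Int.castRingHom ℚ)))
    (by
      intro p hp
      have hmap : ∀ i : Fin n,
          MvPolynomial.map (Int.castRingHom ℚ) (alpha n a i) = alphaQ n a i := by
        intro i
        simp [alpha, alphaQ, map_sum]
      have h : bottIdeal n a ≤
          Ideal.comap (MvPolynomial.map (Int.castRingHom ℚ)) (bottIdealQ n a) := by
        rw [bottIdeal, Ideal.span_le]
        rintro _ ⟨i, rfl⟩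
        simp only [SetLike.mem_coe, Ideal.mem_comap, map_sub, map_mul, map_pow,
          MvPolynomial.map_X, hmap]
        exact Ideal.subset_span ⟨i, rfl⟩
      rw [RingHom.comp_apply]
      exact Ideal.Quotient.eq_zero_iff_mem.mpr (h hp))

/-- The truncated linear form `β̄_ℓ` (rational version): for a 0-based row index `li`,
this is `∑_{k ≤ j < li} b_{li,j} y_j`, i.e. the paper's `β_ℓ` with its terms in
`F_k(B)` removed. -/
noncomputable def bbarQ (b : Mat n) (k : ℕ) (li : Fin n) : BRingQ n b :=
  ∑ j ∈ Finset.univ.filter (fun j : Fin n => k ≤ (j : ℕ) ∧ j < li),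
    (b li j : ℚ) • bxQ n b j

/-- Half of the truncated linear form `β̄_ℓ / 2` (meaningful when all relevant entries
are even), as an element of the integral Bott ring. -/
noncomputable def bbarHalf (b : Mat n) (k : ℕ) (li : Fin n) : BRing n b :=
  ∑ j ∈ Finset.univ.filter (fun j : Fin n => k ≤ (j : ℕ) ∧ j < li),
    (b li j / 2) • bx n b j

/-! ### Switching and twisting -/

/-- The matrix obtained from `b` by exchanging the rows and columns `p` and `q`. -/
def swapMat (b : Mat n) (p q : Fin n) : Mat n :=
  fun i j => b (Equiv.swap p q i) (Equiv.swap p q j)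

/-- `g : R_C → R_{C'}` is a switching isomorphism: for some `j` (0-based `J`) with
`c_{j+1,j} = 0`, `C'` is obtained from `C` by exchanging the `j`-th and `(j+1)`-st rows
and columns, and `g` swaps the `j`-th and `(j+1)`-st generators and fixes the others. -/
def IsSwitch (c c' : Mat n) (g : BRing n c ≃+* BRing n c') : Prop :=
  IsGraded n c c' g ∧
  ∃ (J : ℕ) (hJ : J + 1 < n),
    c ⟨J + 1, hJ⟩ ⟨J, by omega⟩ = 0 ∧
    c' = swapMat n c ⟨J, by omega⟩ ⟨J + 1, hJ⟩ ∧
    ∀ i, g (bx n c i) = bx n c' (Equiv.swap (⟨J, by omega⟩ : Fin n) ⟨J + 1, hJ⟩ i)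

/-- `g : R_C → R_{C'}` is a twisting isomorphism: for some `j` (0-based `J`) and
`v ∈ F_{j−1}(C)` with `v(γ_j − v) = 0`, the rows of `C'` before `j` agree with those of
`C`, `γ'_j = γ_j − 2v`, and `g` is a graded isomorphism fixing the first `j−1`
generators. -/
def IsTwist (c c' : Mat n) (g : BRing n c ≃+* BRing n c') : Prop :=
  IsGraded n c c' g ∧
  ∃ (J : ℕ) (hJ : J < n) (v : BRing n c),
    v ∈ F n c J ∧ v * (bal n c ⟨J, hJ⟩ - v) = 0 ∧
    (∀ i : Fin n, (i : ℕ) < J → ∀ m, c' i m = c i m) ∧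
    ((∑ m, c' ⟨J, hJ⟩ m • bx n c m) = bal n c ⟨J, hJ⟩ - 2 • v) ∧
    (∀ i : Fin n, (i : ℕ) < J → g (bx n c i) = bx n c' i)

/-- `IsMoveComp n c c' g` : `g : R_C → R_{C'}` is a finite (possibly empty) composition
of switching and twisting isomorphisms. -/
inductive IsMoveComp : ∀ c c' : Mat n, (BRing n c ≃+* BRing n c') → Prop
  | refl (c : Mat n) : IsMoveComp c c (RingEquiv.refl _)
  | switch {c c' c'' : Mat n} {g : BRing n c ≃+* BRing n c'}
      {g' : BRing n c' ≃+* BRing n c''} :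
      IsMoveComp c c' g → IsSwitch n c' c'' g' → IsMoveComp c c'' (g.trans g')
  | twist {c c' c'' : Mat n} {g : BRing n c ≃+* BRing n c'}
      {g' : BRing n c' ≃+* BRing n c''} :
      IsMoveComp c c' g → IsTwist n c' c'' g' → IsMoveComp c c'' (g.trans g')

end Defs

/-! ### Block matrices for ℚ-trivial Bott manifolds -/

/-- Starting (0-based) index of the `s`-th block for the partition `lam`. -/
def blockStart (t : ℕ) (lam : Fin t → ℕ) (s : Fin t) : ℕ :=
  ∑ s' ∈ Finset.univ.filter (fun s' : Fin t => s' < s), lam s'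

/-- The block-diagonal matrix with diagonal blocks `H_{λ_1}, …, H_{λ_t}`, where `H_j`
is the `j × j` strictly lower triangular matrix whose first column below the diagonal
consists of `1`s and whose other entries vanish. -/
def blockMat (n t : ℕ) (lam : Fin t → ℕ) : Mat n := fun i j =>
  if ∃ s : Fin t, (j : ℕ) = blockStart t lam s ∧ blockStart t lam s < (i : ℕ) ∧
      (i : ℕ) < blockStart t lam s + lam s then 1 else 0

/-- `H²(ℋ_{λ_s})`: the subgroup of the degree-2 component spanned by the generators
belonging to the `s`-th block. -/
noncomputable def blockH2 (n t : ℕ) (lam : Fin t → ℕ) (s : Fin t) :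
    Submodule ℤ (BRing n (blockMat n t lam)) :=
  Submodule.span ℤ (bx n (blockMat n t lam) ''
    {i : Fin n | blockStart t lam s ≤ (i : ℕ) ∧ (i : ℕ) < blockStart t lam s + lam s})

end Bott

namespace Bott

/-- The linear form with coefficients `c`. -/
noncomputable def lf {n : ℕ} (c : Fin n → ℤ) : MvPolynomial (Fin n) ℤ := ∑ j, C (c j) * X j

lemma lf_zero {n : ℕ} (c : Fin n → ℤ) : constantCoeff (lf c) = 0 := by
  simp [lf]

lemma lf_pderiv {n : ℕ} (c : Fin n → ℤ) (i : Fin n) : pderiv i (lf c) = C (c i) := by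
  classical
  simp [lf, Derivation.leibniz, pderiv_X, Pi.single_apply]

/-- The second order Taylor coefficient functional at zero. -/
noncomputable def dd {n : ℕ} (i j : Fin n) (p : MvPolynomial (Fin n) ℤ) : ℤ :=
  constantCoeff (pderiv i (pderiv j p))

lemma dd_mul_lf {n : ℕ} (i j : Fin n) (q : MvPolynomial (Fin n) ℤ) (b c : Fin n → ℤ) :
    dd i j (q * (lf b * lf c)) = constantCoeff q * (b i * c j + b j * c i) := by
  simp only [dd, Derivation.leibniz, smul_eq_mul, map_add, map_mul, lf_pderiv, lf_zero,
    constantCoeff_C, pderiv_C, map_zero]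
  ring

lemma dd_lf_sq {n : ℕ} (i j : Fin n) (c : Fin n → ℤ) :
    dd i j (lf c ^ 2) = 2 * c i * c j := by
  have h := dd_mul_lf i j 1 c c
  rw [one_mul, ← sq] at h
  rw [h, map_one]
  ring

lemma gen_eq {n : ℕ} (a : Mat n) (k : Fin n) :
    X k ^ 2 - alpha n a k * X k
      = lf (fun i => if i = k then 1 else 0) * lf (fun i => (if i = k then 1 else 0) - a k i) := by
  have h1 : lf (fun i => if i = k then (1 : ℤ) else 0) = X k := by
    simp [lf]
  have h2 : lf (fun i => (if i = k then (1 : ℤ) else 0) - a k i) = X k - alpha n a k := by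
    simp [lf, alpha, sub_mul, Finset.sum_sub_distrib]
  rw [h1, h2]
  ring

/-- The quadratic coefficient identities equivalent to the vanishing of the square. -/
def QI {n : ℕ} (a : Mat n) (c : Fin n → ℤ) : Prop :=
  ∀ i j, 2 * c i * c j = c i ^ 2 * ((if j = i then 1 else 0) - a i j)
    + c j ^ 2 * ((if i = j then 1 else 0) - a j i)

lemma QI_of_mem {n : ℕ} (a : Mat n) (ha : SLT a) (c : Fin n → ℤ)
    (h : lf c ^ 2 ∈ bottIdeal n a) : QI a c := by
  obtain ⟨q, hq⟩ := (Ideal.mem_span_range_iff_exists_fun).1 h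
  have key : ∀ i j, 2 * c i * c j
      = constantCoeff (q i) * ((if j = i then 1 else 0) - a i j)
        + constantCoeff (q j) * ((if i = j then 1 else 0) - a j i) := by
    intro i j
    rw [← dd_lf_sq, ← hq]
    have : dd i j (∑ k, q k * (X k ^ 2 - alpha n a k * X k))
        = ∑ k, dd i j (q k * (X k ^ 2 - alpha n a k * X k)) := by
      simp only [dd, map_sum]
    rw [this]
    simp only [gen_eq, dd_mul_lf, mul_add, Finset.sum_add_distrib]
    simp
  have hd : ∀ i, constantCoeff (q i) = c i ^ 2 := by
    intro i
    have h0 : a i i = 0 := by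
      by_contra h
      exact lt_irrefl _ (ha i i h)
    have := key i i
    simp only [h0, if_true] at this
    linarith
  intro i j
  rw [key i j, hd, hd]

lemma mem_of_QI {n : ℕ} (a : Mat n) (c : Fin n → ℤ) (h : QI a c) :
    lf c ^ 2 ∈ bottIdeal n a := by
  have e : lf c ^ 2 = ∑ k, C (c k ^ 2) * (X k ^ 2 - alpha n a k * X k) := by
    have h1 : lf c ^ 2 = ∑ i, ∑ j, C (c i * c j) * (X i * X j) := by
      rw [sq, lf, Finset.sum_mul_sum]
      refine Finset.sum_congr rfl fun i _ => Finset.sum_congr rfl fun j _ => ?_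
      rw [C_mul]; ring
    have h2 : ∑ k, C (c k ^ 2) * (X k ^ 2 - alpha n a k * X k)
        = ∑ i, ∑ j, C (c i ^ 2 * ((if j = i then 1 else 0) - a i j))
            * (X i * X j : MvPolynomial (Fin n) ℤ) := by
      refine Finset.sum_congr rfl fun i _ => ?_
      have : (X i ^ 2 - alpha n a i * X i : MvPolynomial (Fin n) ℤ)
          = ∑ j, C ((if j = i then 1 else 0) - a i j) * (X i * X j) := by
        simp only [alpha, C_sub, sub_mul, Finset.sum_sub_distrib, Finset.sum_mul]
        congr 1
        · rw [Finset.sum_eq_single i] <;> simp +contextual [sq]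
        · exact Finset.sum_congr rfl fun j _ => by ring
      rw [this, Finset.mul_sum]
      exact Finset.sum_congr rfl fun j _ => by rw [C_mul]; ring
    have h3 : (2 : MvPolynomial (Fin n) ℤ) * lf c ^ 2
        = 2 * ∑ k, C (c k ^ 2) * (X k ^ 2 - alpha n a k * X k) := by
      rw [h2, two_mul (∑ i, ∑ j, _)]
      have hcomm : (∑ i, ∑ j, C (c i ^ 2 * ((if j = i then 1 else 0) - a i j))
            * (X i * X j : MvPolynomial (Fin n) ℤ))
          = ∑ i, ∑ j, C (c j ^ 2 * ((if i = j then 1 else 0) - a j i)) * (X j * X i) :=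
        Finset.sum_comm
      conv_rhs => rw [hcomm]
      conv_rhs => enter [1]; rw [← hcomm]
      rw [← Finset.sum_add_distrib, h1, Finset.mul_sum]
      refine Finset.sum_congr rfl fun i _ => ?_
      rw [← Finset.sum_add_distrib, Finset.mul_sum]
      refine Finset.sum_congr rfl fun j _ => ?_
      have := congrArg (C (σ := Fin n)) (h i j)
      rw [C_add, mul_assoc, C_mul (a := (2 : ℤ))] at this
      rw [mul_comm (X j : MvPolynomial (Fin n) ℤ) (X i), ← add_mul, ← this]
      simp [mul_assoc]
    exact mul_left_cancel₀ two_ne_zero h3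
  rw [e]
  exact Ideal.sum_mem _ fun k _ => Ideal.mul_mem_left _ _ (Ideal.subset_span ⟨k, rfl⟩)

lemma smulQ {n : ℕ} (a : Mat n) (q : ℚ) (x : BRingQ n a) :
    q • x = bmkQ n a (C q) * x := by
  obtain ⟨p, rfl⟩ := Ideal.Quotient.mk_surjective x
  rw [bmkQ, ← map_mul, ← smul_eq_C_mul]
  rfl

/-- Any nonzero `z ∈ H²(A)` with `z² = 0` in `R_A` is of the form
`z = λ(2x_i − α_i)` in `H²(A) ⊗ ℚ` for some index `i` with `α_i² = 0` and some nonzero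
rational `λ`. -/
theorem stmt_2 (n : ℕ) (hn : 1 ≤ n) (a : Mat n) (ha : SLT a)
    (z : BRing n a) (hz2 : z ∈ H2 n a) (hz0 : z ≠ 0) (hzz : z ^ 2 = 0) :
    ∃ (i : Fin n) (lam : ℚ), lam ≠ 0 ∧ bal n a i ^ 2 = 0 ∧
      toQ n a z = lam • toQ n a (2 * bx n a i - bal n a i) := by
  classical
  have hex : ∃ c : Fin n → ℤ, z = bmk n a (lf c) := by
    obtain ⟨c, hc⟩ := (Submodule.mem_span_range_iff_exists_fun ℤ).1 hz2
    refine ⟨c, ?_⟩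
    rw [← hc, lf, map_sum]
    refine Finset.sum_congr rfl fun i _ => ?_
    rw [map_mul, bx, zsmul_eq_mul]
    simp
  obtain ⟨c, rfl⟩ := hex
  have hQ : QI a c := by
    apply QI_of_mem a ha
    rw [← map_pow] at hzz
    exact Ideal.Quotient.eq_zero_iff_mem.1 hzz
  have hne : (Finset.univ.filter fun i => c i ≠ 0).Nonempty := by
    by_contra h
    apply hz0
    have : ∀ i, c i = 0 := by
      intro i
      by_contra hi
      exact h ⟨i, by simp [hi]⟩
    simp [lf, this]
  obtain ⟨k, hk, hmax⟩ := Finset.exists_max_image _ id hne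
  simp only [Finset.mem_filter, Finset.mem_univ, true_and, id] at hk hmax
  have az : ∀ i j : Fin n, i ≤ j → a i j = 0 := by
    intro i j hij
    by_contra h
    exact absurd (ha i j h) (not_lt.2 hij)
  have hc : ∀ i, i ≠ k → 2 * c i = - c k * a k i := by
    intro i hi
    rcases lt_or_gt_of_ne hi with h | h
    · have := hQ i k
      rw [if_neg hi, if_neg hi.symm, az i k h.le] at this
      apply mul_right_cancel₀ hk
      linarith
    · have h0 : c i = 0 := by
        by_contra h0
        exact absurd (hmax i h0) (not_le.2 h)
      rw [h0, az k i h.le]; simp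
  refine ⟨k, (c k : ℚ) / 2, by simpa using hk, ?_, ?_⟩
  · rw [bal, ← map_pow]
    apply Ideal.Quotient.eq_zero_iff_mem.2
    refine mem_of_QI a (a k) ?_
    have off : ∀ i j, j < i → 2 * a k i * a k j = - (a k i ^ 2 * a i j) := by
      intro i j hij
      by_cases hik : k ≤ i
      · rw [az k i hik]; simp
      have hik' : i < k := not_le.1 hik
      have h1 := hc i hik'.ne
      have h2 := hc j (hij.trans hik').ne
      have h3 := hQ i j
      rw [if_neg hij.ne, if_neg hij.ne', az j i hij.le] at h3
      apply mul_left_cancel₀ (pow_ne_zero 2 hk)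
      calc c k ^ 2 * (2 * a k i * a k j) = 2 * (- c k * a k i) * (- c k * a k j) := by ring
        _ = 4 * (2 * c i * c j) := by rw [← h1, ← h2]; ring
        _ = - ((2 * c i) ^ 2 * a i j) := by rw [h3]; ring
        _ = _ := by rw [h1]; ring
    intro i j
    rcases lt_trichotomy i j with h | h | h
    · rw [if_neg h.ne, if_neg h.ne', az i j h.le]
      linarith [off j i h]
    · subst h
      rw [az i i le_rfl]; simp; ring
    · rw [if_neg h.ne, if_neg h.ne', az j i h.le]
      linarith [off i j h]
  · have hp : 2 * lf c = C (c k) * (2 * X k - alpha n a k) := by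
      have e1 : (2 * X k : MvPolynomial (Fin n) ℤ) = ∑ j, C (if j = k then 2 else 0) * X j := by
        rw [Finset.sum_eq_single k] <;> simp +contextual
      rw [e1, alpha, lf, ← Finset.sum_sub_distrib, Finset.mul_sum, Finset.mul_sum]
      refine Finset.sum_congr rfl fun j _ => ?_
      rw [← sub_mul, ← C_sub, ← mul_assoc, ← mul_assoc, ← C_mul]
      congr 1
      rw [show (2 : MvPolynomial (Fin n) ℤ) = C 2 from (map_ofNat C 2).symm, ← C_mul]
      congr 1
      by_cases hj : j = k
      · subst hj; rw [az j j le_rfl]; simp; ring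
      · rw [hc j hj]; simp [hj]
    have hq := congrArg (fun p => toQ n a (bmk n a p)) hp
    simp only [map_mul, map_ofNat, map_sub] at hq
    have hC : toQ n a (bmk n a (C (c k))) = (c k : BRingQ n a) := by
      rw [show (C (c k) : MvPolynomial (Fin n) ℤ) = ((c k : ℤ) : MvPolynomial (Fin n) ℤ) by simp]
      simp
    rw [hC] at hq
    have h5 : bmkQ n a (C ((c k : ℚ) / 2)) * 2 = (c k : BRingQ n a) := by
      rw [← map_ofNat (bmkQ n a) 2, ← map_intCast (bmkQ n a) (c k), ← map_mul]
      congr 1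
      rw [show (OfNat.ofNat 2 : MvPolynomial (Fin n) ℚ) = C 2 from (map_ofNat C 2).symm, ← C_mul]
      simp
    have h6 : bmkQ n a (C (1 / 2 : ℚ)) * 2 = 1 := by
      rw [← map_ofNat (bmkQ n a) 2, ← map_one (bmkQ n a), ← map_mul]
      congr 1
      rw [show (OfNat.ofNat 2 : MvPolynomial (Fin n) ℚ) = C 2 from (map_ofNat C 2).symm, ← C_mul]
      simp
    rw [smulQ]
    simp only [bx, bal, map_mul, map_sub, map_ofNat]
    rw [← h5] at hq
    linear_combination (bmkQ n a (C (1 / 2 : ℚ))) * hq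
      - (toQ n a (bmk n a (lf c)) - bmkQ n a (C ((c k : ℚ) / 2))
        * (2 * toQ n a (bmk n a (X k)) - toQ n a (bmk n a (alpha n a k)))) * h6

end Bott
end

section
/- Let φ : R_A → R_B be a graded ring isomorphism between two Bott rings. Then there exist a permutation σ of {1,…,n} and nonzero rational numbers ε_1,…,ε_n such that φ(2x_i − α_i) = ε_i (2y_{σ(i)} − β_{σ(i)}) in H²(B) ⊗ ℚ for every i = 1,…,n. -/
open MvPolynomial

namespace Bott

/-! ### Helper lemmas: the Jacobian argument -/

/-- Two families with the same multiset of values differ by a permutation. -/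
lemma perm_of_map_eq {α ι : Type*} [Fintype ι] [DecidableEq ι] (f g : ι → α)
    (h : (Finset.univ : Finset ι).val.map f = (Finset.univ : Finset ι).val.map g) :
    ∃ σ : Equiv.Perm ι, ∀ i, g (σ i) = f i := by
  classical
  have e : ∀ c, Nonempty ({i // f i = c} ≃ {i // g i = c}) := by
    intro c
    refine ⟨Fintype.equivOfCardEq ?_⟩
    have := congrArg (Multiset.count c) h
    rw [Multiset.count_map, Multiset.count_map] at this
    rw [Fintype.card_subtype, Fintype.card_subtype]
    simp only [Finset.card, Finset.filter_val]
    simpa [eq_comm] using this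
  exact ⟨Equiv.ofFiberEquiv fun c => (e c).some, fun i => Equiv.ofFiberEquiv_map _ i⟩

/-- The linear form with coefficient vector `v`. -/
noncomputable def lin {R : Type*} [CommRing R] {n : ℕ} (v : Fin n → R) :
    MvPolynomial (Fin n) R := ∑ j, C (v j) * X j

lemma lin_hom {R : Type*} [CommRing R] {n : ℕ} (v : Fin n → R) :
    (lin v).IsHomogeneous 1 := by
  refine IsHomogeneous.sum _ _ _ fun j _ => ?_
  simpa using (isHomogeneous_C (Fin n) (v j)).mul (isHomogeneous_X R j)

lemma coeff_lin {R : Type*} [CommRing R] {n : ℕ} (v : Fin n → R) (i : Fin n) :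
    (lin v).coeff (Finsupp.single i 1) = v i := by
  classical
  rw [lin, coeff_sum, Finset.sum_eq_single i]
  · simp
  · intro j _ hj
    rw [coeff_C_mul, coeff_X, if_neg, mul_zero]
    rwa [Finsupp.single_left_inj Nat.one_ne_zero]
  · simp

lemma pderiv_lin {R : Type*} [CommRing R] {n : ℕ} (v : Fin n → R) (i : Fin n) :
    pderiv i (lin v) = C (v i) := by
  classical
  rw [lin, map_sum, Finset.sum_eq_single i]
  · rw [pderiv_C_mul, pderiv_X_self, mul_one]
  · intro j _ hj
    rw [pderiv_C_mul, pderiv_X_of_ne hj, mul_zero]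
  · simp

lemma lin_irreducible {K : Type*} [Field K] {n : ℕ} (v : Fin n → K) (hv : v ≠ 0) :
    Irreducible (lin v) := by
  obtain ⟨i, hi⟩ := Function.ne_iff.mp hv
  have h0 : lin v ≠ 0 := by
    intro h
    apply hi
    rw [← coeff_lin v i, h]; simp
  apply irreducible_of_totalDegree_eq_one ((lin_hom v).totalDegree h0)
  intro x hx
  have := hx (Finsupp.single i 1)
  rw [coeff_lin] at this
  exact (ne_zero_of_dvd_ne_zero hi this).isUnit

/-- The substitution `x_i ↦ ∑ m_{ij} y_j`. -/
noncomputable def subst {n : ℕ} (m : Mat n) :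
    MvPolynomial (Fin n) ℤ →ₐ[ℤ] MvPolynomial (Fin n) ℤ := aeval fun i => lin (m i)

lemma subst_lin {n : ℕ} (m : Mat n) (v : Fin n → ℤ) :
    subst m (lin v) = lin (fun j => ∑ i, v i * m i j) := by
  simp only [subst, lin, map_sum, map_mul, aeval_X, aeval_C, algebraMap_eq,
    Finset.mul_sum, Finset.sum_mul]
  rw [Finset.sum_comm]
  simp only [mul_assoc]

/-- The chain rule for a linear substitution. -/
lemma pderiv_subst {n : ℕ} (m : Mat n) (p : MvPolynomial (Fin n) ℤ) (j : Fin n) :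
    pderiv j (subst m p) = ∑ i, subst m (pderiv i p) * C (m i j) := by
  classical
  induction p using MvPolynomial.induction_on with
  | C r => simp [subst]
  | add p q hp hq => simp [hp, hq, add_mul, Finset.sum_add_distrib]
  | mul_X p k hp =>
    simp only [Derivation.leibniz, map_mul, map_add, hp, smul_eq_mul, add_mul,
      Finset.sum_add_distrib]
    congr 1
    · rw [Finset.sum_eq_single k]
      · simp [subst, pderiv_lin]
      · intro i _ hi
        rw [pderiv_X_of_ne hi.symm]; simp
      · simp
    · rw [Finset.mul_sum]
      simp only [mul_assoc]

/-- The defining relation. -/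
noncomputable def rel {n : ℕ} (a : Mat n) (i : Fin n) : MvPolynomial (Fin n) ℤ :=
  X i ^ 2 - alpha n a i * X i

/-- coefficient vector of `2 x_i - α_i`. -/
def zv {n : ℕ} (a : Mat n) (i : Fin n) : Fin n → ℤ := 2 • Pi.single i 1 - a i

lemma alpha_eq {n : ℕ} (a : Mat n) (i : Fin n) : alpha n a i = lin (a i) := rfl

lemma lin_zv {n : ℕ} (a : Mat n) (i : Fin n) :
    lin (zv a i) = 2 * X i - alpha n a i := by
  classical
  rw [alpha_eq, lin, lin]
  simp only [zv, Pi.sub_apply, Pi.smul_apply, map_sub, sub_mul, Finset.sum_sub_distrib]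
  congr 1
  rw [Finset.sum_eq_single i]
  · simp
  · intro j _ hj
    simp [hj]
  · simp

lemma rel_hom {n : ℕ} (a : Mat n) (i : Fin n) : (rel a i).IsHomogeneous 2 := by
  refine IsHomogeneous.sub ?_ ?_
  · simpa using (isHomogeneous_X ℤ i).pow 2
  · rw [alpha_eq]
    exact (lin_hom (a i)).mul (isHomogeneous_X ℤ i)

/-- The Jacobian matrix of a family. -/
noncomputable def jac {n : ℕ} (f : Fin n → MvPolynomial (Fin n) ℤ) :
    Matrix (Fin n) (Fin n) (MvPolynomial (Fin n) ℤ) := Matrix.of fun i j => pderiv j (f i)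

lemma jac_det {n : ℕ} (a : Mat n) (ha : SLT a) :
    (jac (rel a)).det = ∏ i, lin (zv a i) := by
  classical
  have hz : ∀ i j : Fin n, i ≤ j → a i j = 0 := by
    intro i j hij
    by_contra h
    have := ha i j h
    exact absurd this (not_lt.mpr hij)
  rw [Matrix.det_of_isLowerTriangular]
  · refine Finset.prod_congr rfl fun i _ => ?_
    rw [lin_zv]
    simp only [jac, rel, Matrix.of_apply, map_sub, Derivation.leibniz, Derivation.leibniz_pow,
      pderiv_X_self, alpha_eq, pderiv_lin, hz i i le_rfl]
    simp
  · intro i j hij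
    have hij : i < j := by simpa using hij
    simp only [jac, rel, Matrix.of_apply, map_sub, Derivation.leibniz, Derivation.leibniz_pow,
      pderiv_X_of_ne hij.ne, alpha_eq, pderiv_lin, hz i j hij.le]
    simp

lemma comp_mul {n : ℕ} (q f : MvPolynomial (Fin n) ℤ) (hf : f.IsHomogeneous 2) :
    homogeneousComponent 2 (q * f) = C (coeff 0 q) * f := by
  letI : GradedAlgebra (homogeneousSubmodule (Fin n) ℤ) := MvPolynomial.gradedAlgebra
  have := DirectSum.coe_decompose_mul_add_of_right_mem (homogeneousSubmodule (Fin n) ℤ)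
    (i := 0) (a := q) (b := f) (j := 2) hf
  have key : ∀ (p : MvPolynomial (Fin n) ℤ) (i : ℕ),
      (DirectSum.decompose (homogeneousSubmodule (Fin n) ℤ) p i : MvPolynomial (Fin n) ℤ)
        = homogeneousComponent i p := fun p i => decomposition.decompose'_apply p i
  rw [key, key, homogeneousComponent_zero] at this
  exact this

lemma mem_deg2 {n : ℕ} (b : Mat n) (p : MvPolynomial (Fin n) ℤ) (hp : p ∈ bottIdeal n b)
    (h2 : p.IsHomogeneous 2) : ∃ c : Fin n → ℤ, p = ∑ k, C (c k) * rel b k := by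
  obtain ⟨q, hq⟩ := Ideal.mem_span_range_iff_exists_fun.mp hp
  refine ⟨fun k => coeff 0 (q k), ?_⟩
  have : homogeneousComponent 2 p = p := by
    rw [homogeneousComponent_of_mem h2]; simp
  rw [← this, ← hq, map_sum]
  exact Finset.sum_congr rfl fun k _ => comp_mul _ _ (rel_hom b k)

/-- The linear part of a Bott ideal is trivial. -/
lemma lin_mem {n : ℕ} (b : Mat n) (v : Fin n → ℤ) (hv : lin v ∈ bottIdeal n b) : v = 0 := by
  classical
  obtain ⟨q, hq⟩ := Ideal.mem_span_range_iff_exists_fun.mp hv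
  funext i
  let D : MvPolynomial (Fin n) ℤ →ₐ[ℤ] DualNumber ℤ :=
    aeval fun j => if j = i then DualNumber.eps else 0
  have hD : ∀ k, D (rel b k) = 0 := by
    intro k
    have hx : ∀ j l, D (X j) * D (X l) = 0 := by
      intro j l
      simp only [D, aeval_X]
      split_ifs <;> simp
    simp only [rel, alpha, map_sub, map_mul, map_sum, pow_two, hx, Finset.sum_mul, mul_assoc,
      mul_zero, Finset.sum_const_zero, sub_zero]
  have h1 : D (lin v) = 0 := by
    rw [← hq, map_sum]
    refine Finset.sum_eq_zero fun k _ => ?_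
    rw [map_mul]
    erw [hD k]
    simp
  have h2 : D (lin v) = v i • DualNumber.eps := by
    simp only [lin, map_sum, map_mul, D, aeval_X, aeval_C]
    rw [Finset.sum_eq_single i]
    · simp [Algebra.smul_def]
    · intro j _ hj
      simp [hj]
    · simp
  rw [h1] at h2
  have := congrArg TrivSqZeroExt.snd h2
  simpa using this.symm

lemma mem_H2 {n : ℕ} (b : Mat n) (z : BRing n b) (hz : z ∈ H2 n b) :
    ∃ v : Fin n → ℤ, z = bmk n b (lin v) := by
  obtain ⟨v, hv⟩ := (Submodule.mem_span_range_iff_exists_fun ℤ).mp hz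
  refine ⟨v, ?_⟩
  rw [← hv, lin, map_sum]
  refine Finset.sum_congr rfl fun j _ => ?_
  rw [map_mul]
  simp [bx]

lemma lift_subst {n : ℕ} (a b : Mat n) (φ : BRing n a →+* BRing n b) (m : Mat n)
    (hm : ∀ i, φ (bx n a i) = bmk n b (lin (m i))) (p : MvPolynomial (Fin n) ℤ) :
    φ (bmk n a p) = bmk n b (subst m p) := by
  have : (φ.comp (bmk n a)) = (bmk n b).comp (subst m).toRingHom := by
    apply MvPolynomial.ringHom_ext
    · intro r; simp
    · intro i
      simpa [subst, bx] using hm i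
  exact congrArg (fun f => f p) this

lemma map_lin {n : ℕ} (v : Fin n → ℤ) :
    MvPolynomial.map (Int.castRingHom ℚ) (lin v) = lin (fun j => (v j : ℚ)) := by
  simp [lin]

lemma toQ_bmk {n : ℕ} (b : Mat n) (p : MvPolynomial (Fin n) ℤ) :
    toQ n b (bmk n b p) = bmkQ n b (MvPolynomial.map (Int.castRingHom ℚ) p) := rfl

/-- For any graded ring isomorphism `φ : R_A → R_B` there are a
permutation `σ` of the indices and nonzero rationals `ε_i` such that
`φ(2x_i − α_i) = ε_i (2y_{σ(i)} − β_{σ(i)})` in `H²(B) ⊗ ℚ` for every `i`. -/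
theorem stmt_6 (n : ℕ) (hn : 1 ≤ n) (a b : Mat n) (ha : SLT a) (hb : SLT b)
    (φ : BRing n a ≃+* BRing n b) (hφ : IsGraded n a b φ) :
    ∃ (σ : Equiv.Perm (Fin n)) (ε : Fin n → ℚ), (∀ i, ε i ≠ 0) ∧
      ∀ i, toQ n b (φ (2 * bx n a i - bal n a i)) =
        ε i • toQ n b (2 * bx n b (σ i) - bal n b (σ i)) := by
  classical
  have hxa : ∀ i, bx n a i ∈ H2 n a := fun i => Submodule.subset_span ⟨i, rfl⟩
  have hxb : ∀ i, bx n b i ∈ H2 n b := fun i => Submodule.subset_span ⟨i, rfl⟩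
  choose m hm using fun i => mem_H2 b _ (hφ.1 _ (hxa i))
  choose m' hm' using fun i => mem_H2 a _ (hφ.2 _ (hxb i))
  have hL := lift_subst a b φ.toRingHom m hm
  have hL' := lift_subst b a φ.symm.toRingHom m' hm'
  have hmm : ∀ v : Fin n → ℤ, subst m' (subst m (lin v)) = lin v := by
    intro v
    have h1 : bmk n a (subst m' (subst m (lin v))) = bmk n a (lin v) := by
      rw [← hL', ← hL]
      exact φ.symm_apply_apply _
    rw [subst_lin, subst_lin] at h1 ⊢
    have h2 := Ideal.Quotient.eq.mp h1
    set w : Fin n → ℤ := fun j => ∑ i, (∑ i_1, v i_1 * m i_1 i) * m' i j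
    have h3 : lin w - lin v = lin (w - v) := by
      simp [lin, sub_mul, Finset.sum_sub_distrib]
    rw [h3] at h2
    rw [sub_eq_zero.mp (lin_mem a _ h2)]
  have hinj : ∀ v : Fin n → ℤ, v ≠ 0 → (fun j => ∑ i, v i * m i j) ≠ 0 := by
    intro v hv h
    have h1 := hmm v
    rw [subst_lin, h] at h1
    apply hv
    funext i
    rw [← coeff_lin v i, ← h1]
    simp [lin]
  have hdet : (Matrix.of m).det ≠ 0 := by
    intro h
    obtain ⟨v, hv, hv'⟩ := Matrix.exists_vecMul_eq_zero_iff.mpr h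
    exact hinj v hv hv'
  have hzv : ∀ (c : Mat n), SLT c → ∀ i, zv c i ≠ 0 := by
    intro c hc i h
    have h1 := congrFun h i
    have h2 : c i i = 0 := by
      by_contra h3
      exact lt_irrefl _ (hc i i h3)
    simp [zv, h2] at h1
  -- the relations
  have hrel : ∀ i, ∃ c : Fin n → ℤ, subst m (rel a i) = ∑ k, C (c k) * rel b k := by
    intro i
    apply mem_deg2
    · have h0 : bmk n a (rel a i) = 0 :=
        Ideal.Quotient.eq_zero_iff_mem.mpr (Ideal.subset_span ⟨i, rfl⟩)
      have h1 := hL (rel a i)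
      rw [h0, map_zero] at h1
      exact Ideal.Quotient.eq_zero_iff_mem.mp h1.symm
    · have h1 : subst m (rel a i) = lin (m i) ^ 2 - subst m (lin (a i)) * lin (m i) := by
        rw [rel, alpha_eq, map_sub, map_mul, map_pow]
        simp [subst]
      rw [h1, subst_lin]
      exact IsHomogeneous.sub (by simpa using (lin_hom (m i)).pow 2)
        ((lin_hom _).mul (lin_hom _))
  choose c hc using hrel
  have hJ : (jac (rel a)).map (subst m) * (Matrix.of m).map C
      = (Matrix.of c).map C * jac (rel b) := by
    ext1 i j
    rw [Matrix.mul_apply, Matrix.mul_apply]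
    have h1 := pderiv_subst m (rel a i) j
    rw [hc, map_sum] at h1
    simp only [pderiv_C_mul] at h1
    simpa [jac] using h1.symm
  have hprod : (∏ i, subst m (lin (zv a i))) * C (Matrix.of m).det
      = C (Matrix.of c).det * ∏ i, lin (zv b i) := by
    have h1 := congrArg Matrix.det hJ
    rw [Matrix.det_mul, Matrix.det_mul, jac_det b hb] at h1
    have h2 : ((jac (rel a)).map (subst m)).det = ∏ i, subst m (lin (zv a i)) := by
      rw [← map_prod, ← jac_det a ha]
      exact ((subst m).map_det _).symm
    have h3 : ∀ e : Mat n, ((Matrix.of e).map (C : ℤ →+* MvPolynomial (Fin n) ℤ)).det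
        = C (Matrix.of e).det := fun e => (RingHom.map_det _ _).symm
    rwa [h2, h3, h3] at h1
  -- pass to rational coefficients
  let u : Fin n → Fin n → ℚ := fun i j => ((∑ k, zv a i k * m k j : ℤ) : ℚ)
  let w : Fin n → Fin n → ℚ := fun i j => ((zv b i j : ℤ) : ℚ)
  have hu : ∀ i, MvPolynomial.map (Int.castRingHom ℚ) (subst m (lin (zv a i))) = lin (u i) := by
    intro i; rw [subst_lin, map_lin]
  have hw : ∀ i, MvPolynomial.map (Int.castRingHom ℚ) (lin (zv b i)) = lin (w i) := by
    intro i; rw [map_lin]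
  have hui : ∀ i, Irreducible (lin (u i)) := by
    intro i
    apply lin_irreducible
    intro h
    apply hinj _ (hzv a ha i)
    funext j
    have h1 : ((∑ k, zv a i k * m k j : ℤ) : ℚ) = 0 := congrFun h j
    exact Int.cast_eq_zero.mp h1
  have hwi : ∀ i, Irreducible (lin (w i)) := by
    intro i
    apply lin_irreducible
    intro h
    apply hzv b hb i
    funext j
    have h1 : ((zv b i j : ℤ) : ℚ) = 0 := congrFun h j
    exact Int.cast_eq_zero.mp h1
  have hQ := congrArg (MvPolynomial.map (Int.castRingHom ℚ)) hprod
  simp only [map_mul, map_prod, hu, hw, map_C] at hQ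
  have hd : ((Matrix.of m).det : ℚ) ≠ 0 := by exact_mod_cast hdet
  have hcd : ((Matrix.of c).det : ℚ) ≠ 0 := by
    intro h
    have h0 : (∏ i, lin (u i)) * C ((Matrix.of m).det : ℚ) ≠ 0 :=
      mul_ne_zero (Finset.prod_ne_zero_iff.mpr fun i _ => (hui i).ne_zero) (by simpa using hdet)
    apply h0
    refine hQ.trans ?_
    simp [h]
  have hCu : ∀ r : ℚ, r ≠ 0 → IsUnit (C r : MvPolynomial (Fin n) ℚ) := fun r hr =>
    (IsUnit.mk0 r hr).map C
  have hassoc : Associated (∏ i, lin (u i)) (∏ i, lin (w i)) := by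
    have h1 : Associated (∏ i, lin (u i)) ((∏ i, lin (u i)) * C ((Matrix.of m).det : ℚ)) :=
      associated_mul_unit_right _ _ (hCu _ hd)
    have h2 : Associated (∏ i, lin (w i)) (C ((Matrix.of c).det : ℚ) * ∏ i, lin (w i)) :=
      associated_unit_mul_right _ _ (hCu _ hcd)
    refine h1.trans (Associated.trans ?_ h2.symm)
    exact Associated.of_eq hQ
  have hR := UniqueFactorizationMonoid.factors_unique
    (f := (Finset.univ : Finset (Fin n)).val.map fun i => lin (u i))
    (g := (Finset.univ : Finset (Fin n)).val.map fun i => lin (w i))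
    (by
      intro x hx
      obtain ⟨i, _, rfl⟩ := Multiset.mem_map.mp hx
      exact hui i)
    (by
      intro x hx
      obtain ⟨i, _, rfl⟩ := Multiset.mem_map.mp hx
      exact hwi i) hassoc
  rw [Associates.rel_associated_iff_map_eq_map, Multiset.map_map, Multiset.map_map] at hR
  obtain ⟨σ, hσ⟩ := perm_of_map_eq _ _ hR
  have hε : ∀ i, ∃ r : ℚ, r ≠ 0 ∧ lin (u i) = C r * lin (w (σ i)) := by
    intro i
    obtain ⟨t, ht⟩ := Associates.mk_eq_mk_iff_associated.mp (hσ i)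
    obtain ⟨r, hr, hr'⟩ := MvPolynomial.isUnit_iff_eq_C_of_isReduced.mp t.isUnit
    refine ⟨r, hr.ne_zero, ?_⟩
    rw [hr', mul_comm] at ht
    exact ht.symm
  choose ε hε0 hε using hε
  refine ⟨σ, ε, hε0, fun i => ?_⟩
  have e1 : ∀ (e : Mat n) (j : Fin n), 2 * bx n e j - bal n e j = bmk n e (lin (zv e j)) := by
    intro e j
    rw [lin_zv, map_sub, map_mul, map_ofNat]
    rfl
  have e2 : φ (bmk n a (lin (zv a i))) = bmk n b (subst m (lin (zv a i))) := hL _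
  rw [e1, e1, e2, toQ_bmk, toQ_bmk, hu, hw, hε, ← MvPolynomial.smul_eq_C_mul]
  rfl

end Bott
end

section
/- Let λ = (λ_1,…,λ_t) be a partition of n and let R be the Bott ring of the block-diagonal matrix with blocks H_{λ_1},…,H_{λ_t}, so R ≅ H*(ℋ_{λ_1}) ⊗ … ⊗ H*(ℋ_{λ_t}). Then every graded ring automorphism φ of R permutes the block summands of the degree-2 component: for each i there exists i' such that φ maps H²(ℋ_{λ_i}) isomorphically onto H²(ℋ_{λ_{i'}}). -/
open MvPolynomial

namespace Bott

section Aux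

open scoped DualNumber

variable {n : ℕ} {a : Mat n}

/-- Universal property of the Bott ring. -/
theorem exists_hom {S : Type} [CommRing S] (v : Fin n → S)
    (h : ∀ i, v i ^ 2 = (∑ j, (a i j : S) * v j) * v i) :
    ∃ f : BRing n a →+* S, ∀ i, f (bx n a i) = v i := by
  have hle : bottIdeal n a ≤ RingHom.ker (eval₂Hom (Int.castRingHom S) v) := by
    rw [bottIdeal, Ideal.span_le]
    rintro _ ⟨i, rfl⟩
    have hC : ∀ m : ℤ, eval₂Hom (Int.castRingHom S) v (C m) = (m : S) := fun m => by simp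
    have hX : ∀ k, eval₂Hom (Int.castRingHom S) v (X k) = v k := fun k => by simp
    simp only [SetLike.mem_coe, RingHom.mem_ker, alpha, map_sub, map_mul, map_pow, map_sum, hC, hX]
    rw [h i, sub_self]
  refine ⟨Ideal.Quotient.lift _ (eval₂Hom (Int.castRingHom S) v) (fun p hp => RingHom.mem_ker.mp (hle hp)), ?_⟩
  intro i
  exact (Ideal.Quotient.lift_mk _ _ _).trans (by simp)

theorem exists_coord (i : Fin n) :
    ∃ d : BRing n a →+ ℤ, ∀ k, d (bx n a k) = if k = i then 1 else 0 := by
  obtain ⟨f, hf⟩ := exists_hom (a := a) (S := DualNumber ℤ)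
    (fun k => if k = i then ε else 0) (by
      intro k
      rw [Finset.sum_mul]
      symm
      have h0 : ∀ j k : Fin n, (if j = i then (ε : DualNumber ℤ) else 0) *
          (if k = i then (ε : DualNumber ℤ) else 0) = 0 := by
        intro j k
        split_ifs <;> simp
      rw [pow_two, h0]
      apply Finset.sum_eq_zero
      intro j _
      rw [mul_assoc, h0, mul_zero])
  refine ⟨(TrivSqZeroExt.sndHom ℤ ℤ).toAddMonoidHom.comp f.toAddMonoidHom, ?_⟩
  intro k
  have : (((TrivSqZeroExt.sndHom ℤ ℤ).toAddMonoidHom.comp f.toAddMonoidHom) (bx n a k))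
    = TrivSqZeroExt.snd (f (bx n a k)) := rfl
  rw [this, hf]
  split_ifs <;> simp

/-- The coordinates with respect to the generators. -/
noncomputable def crd (a : Mat n) (i : Fin n) : BRing n a →+ ℤ := (exists_coord (a := a) i).choose

theorem crd_bx (i k : Fin n) : crd a i (bx n a k) = if k = i then 1 else 0 :=
  (exists_coord (a := a) i).choose_spec k

theorem bx_mem (i : Fin n) : bx n a i ∈ H2 n a := Submodule.subset_span ⟨i, rfl⟩

theorem H2_eq {z : BRing n a} (hz : z ∈ H2 n a) : z = ∑ i, crd a i z • bx n a i := by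
  induction hz using Submodule.span_induction with
  | mem x hx =>
    obtain ⟨k, rfl⟩ := hx
    simp [crd_bx]
  | zero => simp
  | add x y _ _ hx hy =>
    simp only [map_add, add_smul, Finset.sum_add_distrib]
    rw [← hx, ← hy]
  | smul m x _ hx =>
    simp only [map_zsmul, smul_assoc]
    rw [← Finset.smul_sum, ← hx]

/-- The span of a fibre of `r`. -/
noncomputable def fib (a : Mat n) (r : Fin n → Fin n) (k : Fin n) : Submodule ℤ (BRing n a) :=
  Submodule.span ℤ (bx n a '' {i | r i = k})

theorem crd_of_fib {r : Fin n → Fin n} {k : Fin n} {z : BRing n a} (hz : z ∈ fib a r k)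
    {j : Fin n} (hj : r j ≠ k) : crd a j z = 0 := by
  induction hz using Submodule.span_induction with
  | mem x hx =>
    obtain ⟨i, hi, rfl⟩ := hx
    rw [crd_bx, if_neg]
    rintro rfl
    exact hj hi
  | zero => simp
  | add x y _ _ hx hy => simp [hx, hy]
  | smul m x _ hx => rw [map_zsmul, hx, smul_zero]

theorem mem_fib {r : Fin n → Fin n} {k : Fin n} {z : BRing n a} (hz : z ∈ H2 n a)
    (h : ∀ j, r j ≠ k → crd a j z = 0) : z ∈ fib a r k := by
  rw [H2_eq hz]
  refine Submodule.sum_mem _ fun i _ => ?_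
  by_cases hi : r i = k
  · exact Submodule.smul_mem _ _ (Submodule.subset_span ⟨i, hi, rfl⟩)
  · simp [h i hi]

theorem mem_fib_of_two {r : Fin n → Fin n} {k : Fin n} {z : BRing n a} (hz : z ∈ H2 n a)
    (h : 2 * z ∈ fib a r k) : z ∈ fib a r k := by
  refine mem_fib hz fun j hj => ?_
  have := crd_of_fib h hj
  rw [two_mul, map_add] at this
  omega

/-- The square-zero generators. -/
noncomputable def yy (a : Mat n) (r : Fin n → Fin n) (i : Fin n) : BRing n a :=
  if r i = i then bx n a i else 2 * bx n a i - bx n a (r i)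

theorem two_mem {M : Submodule ℤ (BRing n a)} {z : BRing n a} (h : z ∈ M) : 2 * z ∈ M := by
  rw [two_mul]; exact M.add_mem h h

theorem yy_mem (r : Fin n → Fin n) (i : Fin n) : yy a r i ∈ H2 n a := by
  unfold yy
  split_ifs
  · exact bx_mem i
  · exact Submodule.sub_mem _ (two_mem (bx_mem i)) (bx_mem _)

theorem yy_fib {r : Fin n → Fin n} (hr : ∀ i, r (r i) = r i) (i : Fin n) :
    yy a r i ∈ fib a r (r i) := by
  have h1 : bx n a i ∈ fib a r (r i) := Submodule.subset_span ⟨i, rfl, rfl⟩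
  have h2 : bx n a (r i) ∈ fib a r (r i) := Submodule.subset_span ⟨r i, hr i, rfl⟩
  unfold yy
  split_ifs
  · exact h1
  · exact Submodule.sub_mem _ (two_mem h1) h2

/-- `a` is the matrix associated with the root map `r`. -/
def IsRoot (a : Mat n) (r : Fin n → Fin n) : Prop :=
  ∀ i j, a i j = if r i = j ∧ r i ≠ i then 1 else 0

theorem sum_root {r : Fin n → Fin n} (ha : IsRoot a r) {S : Type} [CommRing S] (v : Fin n → S)
    (i : Fin n) : ∑ j, (a i j : S) * v j = if r i = i then 0 else v (r i) := by
  by_cases h : r i = i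
  · simp [ha i, h]
  · simp [ha i, h]

theorem bx_sq {r : Fin n → Fin n} (ha : IsRoot a r) (i : Fin n) :
    bx n a i ^ 2 = if r i = i then 0 else bx n a (r i) * bx n a i := by
  have h1 : bmk n a (X i ^ 2 - alpha n a i * X i) = 0 :=
    Ideal.Quotient.eq_zero_iff_mem.mpr (Ideal.subset_span ⟨i, rfl⟩)
  have h2 : bx n a i ^ 2 = (∑ j, (a i j : BRing n a) * bx n a j) * bx n a i := by
    have : bmk n a (alpha n a i) = ∑ j, (a i j : BRing n a) * bx n a j := by
      simp [alpha, bx]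
    rw [map_sub, map_mul, map_pow, this, sub_eq_zero] at h1
    exact h1
  rw [h2, sum_root ha]
  split_ifs <;> simp

theorem yy_sq {r : Fin n → Fin n} (hr : ∀ i, r (r i) = r i) (ha : IsRoot a r) (i : Fin n) :
    yy a r i ^ 2 = 0 := by
  have h1 := bx_sq ha i
  have h2 := bx_sq ha (r i)
  rw [if_pos (hr i)] at h2
  unfold yy
  split_ifs with h
  · rw [if_pos h] at h1; exact h1
  · rw [if_neg h] at h1
    linear_combination 4 * h1 + h2

theorem exists_two {r : Fin n → Fin n} (hr : ∀ i, r (r i) = r i) {z : BRing n a}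
    (hz : z ∈ H2 n a) : ∃ m : Fin n → ℤ, 2 * z = ∑ i, m i • yy a r i := by
  induction hz using Submodule.span_induction with
  | mem x hx =>
    obtain ⟨k, rfl⟩ := hx
    by_cases h : r k = k
    · refine ⟨fun i => if i = k then 2 else 0, ?_⟩
      have h1 : yy a r k = bx n a k := if_pos h
      simp only [ite_smul, zero_smul, Finset.sum_ite_eq', Finset.mem_univ, if_true, h1]
      rw [two_smul, two_mul]
    · refine ⟨fun i => (if i = k then 1 else 0) + (if i = r k then 1 else 0), ?_⟩
      have h1 : yy a r k = 2 * bx n a k - bx n a (r k) := if_neg h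
      have h2 : yy a r (r k) = bx n a (r k) := if_pos (hr k)
      simp only [add_smul, Finset.sum_add_distrib, ite_smul, zero_smul, one_smul,
        Finset.sum_ite_eq', Finset.mem_univ, if_true, h1, h2]
      ring
  | zero => exact ⟨0, by simp⟩
  | add x y _ _ hx hy =>
    obtain ⟨m, hm⟩ := hx
    obtain ⟨m', hm'⟩ := hy
    exact ⟨m + m', by simp [mul_add, hm, hm', add_smul, Finset.sum_add_distrib]⟩
  | smul c x _ hx =>
    obtain ⟨m, hm⟩ := hx
    refine ⟨fun i => c * m i, ?_⟩
    rw [mul_smul_comm, hm, Finset.smul_sum]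
    exact Finset.sum_congr rfl fun i _ => (mul_smul _ _ _).symm

theorem exists_hom_yy {r : Fin n → Fin n} (hr : ∀ i, r (r i) = r i) (ha : IsRoot a r)
    {S : Type} [CommRing S] [Algebra ℚ S] (e : Fin n → S) (he : ∀ i, e i ^ 2 = 0) :
    ∃ f : BRing n a →+* S, ∀ i, f (yy a r i) = e i := by
  obtain ⟨q, hq⟩ : ∃ q : S, 2 * q = 1 := ⟨algebraMap ℚ S (1 / 2), by
    have : (2 : S) = algebraMap ℚ S 2 := (map_ofNat (algebraMap ℚ S) 2).symm
    rw [this, ← map_mul]; norm_num⟩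
  obtain ⟨f, hf⟩ := exists_hom (a := a) (fun k => if r k = k then e k else q * (e k + e (r k)))
    (by
      intro i
      rw [sum_root ha]
      simp only [hr i, if_true]
      split_ifs with h
      · simp [he]
      · have h1 := he i
        have h2 := he (r i)
        linear_combination q ^ 2 * h1 + (q^2 - q) * h2 + (q * e i * e (r i)) * hq)
  refine ⟨f, fun i => ?_⟩
  unfold yy
  split_ifs with h
  · simp [hf, h]
  · simp only [map_sub, map_mul, hf, h, hr i, if_true, if_false, map_ofNat]
    linear_combination (e i + e (r i)) * hq

theorem sq_zero_mem {r : Fin n → Fin n} (hr : ∀ i, r (r i) = r i) (ha : IsRoot a r)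
    {z : BRing n a} (hz : z ∈ H2 n a) (h : z ^ 2 = 0) (i₀ : Fin n) :
    ∃ k, r k = k ∧ z ∈ fib a r k := by
  obtain ⟨m, hm⟩ := exists_two hr hz
  have key : ∀ i j, i ≠ j → m i ≠ 0 → m j = 0 := by
    intro i j hij hi
    obtain ⟨f, hf⟩ := exists_hom_yy hr ha (S := DualNumber (DualNumber ℚ))
      (fun k => if k = i then TrivSqZeroExt.inl ε else if k = j then ε else 0) (by
        intro k
        simp only [pow_two]
        split_ifs
        · rw [← TrivSqZeroExt.inl_mul]; simp
        · simp
        · simp)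
    have h1 : f (2 * z) = (m i : DualNumber (DualNumber ℚ)) * TrivSqZeroExt.inl ε
        + (m j : DualNumber (DualNumber ℚ)) * ε := by
      rw [hm, map_sum]
      simp only [map_zsmul, hf]
      rw [Finset.sum_eq_add i j hij]
      · simp [hij.symm]
      · intro c _ hc
        simp [hc.1, hc.2]
      · simp
      · simp
    have h2 : f (2 * z) ^ 2 = 0 := by
      rw [← map_pow, mul_pow, h, mul_zero, map_zero]
    rw [h1] at h2
    have h3 := congrArg (fun w => TrivSqZeroExt.snd (TrivSqZeroExt.snd w)) h2
    simp [pow_two] at h3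
    have h4 : m i * m j + m j * m i = 0 := by exact_mod_cast h3
    have h5 : m i * m j = 0 := by linarith
    exact (mul_eq_zero.mp h5).resolve_left hi
  by_cases h0 : ∃ i, m i ≠ 0
  · obtain ⟨i, hi⟩ := h0
    refine ⟨r i, hr i, mem_fib_of_two hz ?_⟩
    rw [hm, Finset.sum_eq_single i]
    · exact Submodule.smul_mem _ _ (yy_fib hr i)
    · intro j _ hj
      rw [key i j hj.symm hi, zero_smul]
    · simp
  · push Not at h0
    refine ⟨r i₀, hr i₀, mem_fib_of_two hz ?_⟩
    rw [hm]
    simp [h0]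

theorem map_fib {r : Fin n → Fin n} (hr : ∀ i, r (r i) = r i) (ha : IsRoot a r)
    (φ : BRing n a ≃+* BRing n a) (hφ : IsGraded n a a φ) (k : Fin n) (hk : r k = k) :
    ∃ k', r k' = k' ∧ ∀ z ∈ fib a r k, φ z ∈ fib a r k' := by
  have hy : ∀ i, ∃ k', r k' = k' ∧ φ (yy a r i) ∈ fib a r k' := fun i =>
    sq_zero_mem hr ha (hφ.1 _ (yy_mem r i)) (by rw [← map_pow, yy_sq hr ha, map_zero]) k
  obtain ⟨k', hk', hkk⟩ := hy k
  have hyk : yy a r k = bx n a k := by simp [yy, hk]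
  rw [hyk] at hkk
  refine ⟨k', hk', ?_⟩
  have hx : ∀ i, r i = k → φ (bx n a i) ∈ fib a r k' := by
    intro i hi
    by_cases hik : i = k
    · rw [hik]; exact hkk
    obtain ⟨k'', hk'', hi'⟩ := hy i
    have hyi : yy a r i = 2 * bx n a i - bx n a k := by
      have : ¬ k = i := fun h => hik h.symm
      simp [yy, hi, this]
    have hsum : 2 * φ (bx n a i) = φ (yy a r i) + φ (bx n a k) := by
      rw [hyi, map_sub, map_mul, map_ofNat]; ring
    by_cases hkk' : k'' = k'
    · subst hkk'
      apply mem_fib_of_two (hφ.1 _ (bx_mem i))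
      rw [hsum]
      exact Submodule.add_mem _ hi' hkk
    · exfalso
      have hev : ∀ j, ∃ c : ℤ, crd a j (φ (bx n a k)) = 2 * c := by
        intro j
        by_cases hj : r j = k'
        · have h1 : crd a j (φ (yy a r i)) = 0 :=
            crd_of_fib hi' (by rw [hj]; exact fun h => hkk' h.symm)
          have h2 := congrArg (crd a j) hsum
          rw [two_mul, map_add, map_add, h1] at h2
          exact ⟨crd a j (φ (bx n a i)), by omega⟩
        · exact ⟨0, by rw [crd_of_fib hkk hj]; rfl⟩
      choose c hc using hev
      have hw : φ (bx n a k) = 2 * ∑ j, c j • bx n a j := by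
        rw [H2_eq (hφ.1 _ (bx_mem k)), Finset.mul_sum]
        refine Finset.sum_congr rfl fun j _ => ?_
        rw [hc j, mul_smul, two_mul, two_smul]
      have h3 := congrArg φ.symm hw
      rw [RingEquiv.symm_apply_apply, map_mul, map_ofNat, two_mul] at h3
      have h4 := congrArg (crd a k) h3
      rw [crd_bx, if_pos rfl, map_add] at h4
      omega
  intro z hz
  induction hz using Submodule.span_induction with
  | mem x hx' =>
    obtain ⟨i, hi, rfl⟩ := hx'
    exact hx i hi
  | zero => rw [map_zero]; exact Submodule.zero_mem _
  | add x y _ _ hx hy => rw [map_add]; exact Submodule.add_mem _ hx hy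
  | smul m x _ hx => rw [map_zsmul]; exact Submodule.smul_mem _ _ hx

theorem image_fib {r : Fin n → Fin n} (hr : ∀ i, r (r i) = r i) (ha : IsRoot a r)
    (φ : BRing n a ≃+* BRing n a) (hφ : IsGraded n a a φ) (k : Fin n) (hk : r k = k) :
    ∃ k', r k' = k' ∧ ⇑φ '' (fib a r k : Set (BRing n a)) = fib a r k' := by
  obtain ⟨k', hk', h1⟩ := map_fib hr ha φ hφ k hk
  obtain ⟨l, hl, h2⟩ := map_fib hr ha φ.symm ⟨hφ.2, hφ.1⟩ k' hk'
  have hkl : k = l := by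
    by_contra hne
    have hmem : bx n a k ∈ fib a r k := Submodule.subset_span ⟨k, hk, rfl⟩
    have h3 := h2 _ (h1 _ hmem)
    rw [RingEquiv.symm_apply_apply] at h3
    have h4 := crd_of_fib h3 (j := k) (by rw [hk]; exact hne)
    rw [crd_bx, if_pos rfl] at h4
    exact one_ne_zero h4
  subst hkl
  refine ⟨k', hk', Set.Subset.antisymm ?_ ?_⟩
  · rintro _ ⟨z, hz, rfl⟩
    exact h1 z hz
  · intro w hw
    exact ⟨φ.symm w, h2 w hw, RingEquiv.apply_symm_apply _ _⟩

end Aux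

theorem blockStart_le {t : ℕ} (lam : Fin t → ℕ) {s s' : Fin t} (h : s < s') :
    blockStart t lam s + lam s ≤ blockStart t lam s' := by
  unfold blockStart
  have hn : s ∉ Finset.univ.filter (fun u : Fin t => u < s) := by simp
  rw [add_comm, ← Finset.sum_insert hn]
  apply Finset.sum_le_sum_of_subset
  intro u hu
  simp only [Finset.mem_insert, Finset.mem_filter, Finset.mem_univ, true_and] at hu ⊢
  rcases hu with rfl | hu
  · exact h
  · exact hu.trans h

theorem block_unique {t : ℕ} (lam : Fin t → ℕ) {s s' : Fin t} {i : ℕ}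
    (h1 : blockStart t lam s ≤ i) (h2 : i < blockStart t lam s + lam s)
    (h3 : blockStart t lam s' ≤ i) (h4 : i < blockStart t lam s' + lam s') : s = s' := by
  rcases lt_trichotomy s s' with h | h | h
  · have := blockStart_le lam h
    omega
  · exact h
  · have := blockStart_le lam h
    omega

theorem block_exists {t : ℕ} (lam : Fin t → ℕ) (i : ℕ) (hi : i < ∑ s, lam s) :
    ∃ s, blockStart t lam s ≤ i ∧ i < blockStart t lam s + lam s := by
  have key : ∀ m ≤ t, i < ∑ u ∈ Finset.univ.filter (fun u : Fin t => (u : ℕ) < m), lam u →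
      ∃ s, blockStart t lam s ≤ i ∧ i < blockStart t lam s + lam s := by
    intro m
    induction m with
    | zero => intro _ h; simp at h
    | succ m ih =>
      intro hm h
      by_cases h' : i < ∑ u ∈ Finset.univ.filter (fun u : Fin t => (u : ℕ) < m), lam u
      · exact ih (by omega) h'
      · have hst : blockStart t lam ⟨m, hm⟩ =
            ∑ u ∈ Finset.univ.filter (fun u : Fin t => (u : ℕ) < m), lam u := rfl
        refine ⟨⟨m, hm⟩, by rw [hst]; omega, ?_⟩
        have hn : (⟨m, hm⟩ : Fin t) ∉ Finset.univ.filter (fun u : Fin t => (u : ℕ) < m) := by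
          simp
        rw [hst, add_comm, ← Finset.sum_insert hn]
        convert h using 2
        ext u
        simp only [Finset.mem_insert, Finset.mem_filter, Finset.mem_univ, true_and, Fin.ext_iff]
        omega
  refine key t le_rfl ?_
  convert hi using 2
  ext u
  simp

/-- Let `λ = (λ_1, …, λ_t)` be a partition of `n` and `R` the Bott
ring of the block-diagonal matrix with blocks `H_{λ_1}, …, H_{λ_t}`.  Then every
graded ring automorphism `φ` of `R` permutes the block summands of the degree-2
component: for each `s` there is `s'` with `φ(H²(ℋ_{λ_s})) = H²(ℋ_{λ_{s'}})`
(the restriction being an isomorphism since `φ` is injective). -/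
theorem stmt_8 (n : ℕ) (hn : 1 ≤ n) (t : ℕ) (lam : Fin t → ℕ)
    (hlam : ∀ s, 1 ≤ lam s) (hsum : ∑ s, lam s = n)
    (φ : BRing n (blockMat n t lam) ≃+* BRing n (blockMat n t lam))
    (hφ : IsGraded n (blockMat n t lam) (blockMat n t lam) φ) :
    ∀ s : Fin t, ∃ s' : Fin t,
      ⇑φ '' (blockH2 n t lam s : Set (BRing n (blockMat n t lam))) =
        (blockH2 n t lam s' : Set (BRing n (blockMat n t lam))) := by
  have hbs : ∀ s, blockStart t lam s + lam s ≤ n := by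
    intro s
    unfold blockStart
    have hns : s ∉ Finset.univ.filter (fun u : Fin t => u < s) := by simp
    rw [add_comm, ← Finset.sum_insert hns, ← hsum]
    exact Finset.sum_le_sum_of_subset (Finset.subset_univ _)
  choose b hb1 hb2 using fun i : Fin n => block_exists lam i (by rw [hsum]; exact i.2)
  have hlt : ∀ s, blockStart t lam s < n := fun s => by
    have := hbs s
    have := hlam s
    omega
  let st : Fin t → Fin n := fun s => ⟨blockStart t lam s, hlt s⟩
  have hst : ∀ s, ((st s : Fin n) : ℕ) = blockStart t lam s := fun s => rfl
  have hbst : ∀ s, b (st s) = s := fun s => by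
    refine block_unique lam (hb1 _) (hb2 _) ?_ ?_
    · exact le_rfl
    · have := hlam s
      rw [hst]
      omega
  let r : Fin n → Fin n := fun i => st (b i)
  have hr : ∀ i, r (r i) = r i := fun i => congrArg st (hbst (b i))
  have ha : IsRoot (blockMat n t lam) r := by
    intro i j
    unfold blockMat
    refine if_congr ?_ rfl rfl
    constructor
    · rintro ⟨s, h1, h2, h3⟩
      have hs : b i = s := block_unique lam (hb1 i) (hb2 i) h2.le h3
      have hri : r i = st s := congrArg st hs
      refine ⟨?_, ?_⟩
      · rw [hri]; exact Fin.ext h1.symm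
      · rw [hri]
        intro h
        have := congrArg Fin.val h
        rw [hst] at this
        omega
    · rintro ⟨h1, h2⟩
      refine ⟨b i, ?_, ?_, hb2 i⟩
      · rw [← h1]
      · refine lt_of_le_of_ne (hb1 i) fun h => h2 (Fin.ext h)
  have hfib : ∀ s, blockH2 n t lam s = fib (blockMat n t lam) r (st s) := by
    intro s
    unfold blockH2 fib
    congr 2
    ext i
    simp only [Set.mem_ofPred_eq]
    constructor
    · rintro ⟨h1, h2⟩
      exact congrArg st (block_unique lam (hb1 i) (hb2 i) h1 h2)
    · intro h
      have hs : b i = s := by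
        have := congrArg b h
        exact (hbst (b i)).symm.trans (this.trans (hbst s))
      rw [← hs]
      exact ⟨hb1 i, hb2 i⟩
  intro s
  obtain ⟨k', hk', him⟩ := image_fib hr ha φ hφ (st s) (congrArg st (hbst s))
  refine ⟨b k', ?_⟩
  rw [hfib, hfib, him]
  have : st (b k') = k' := hk'
  rw [this]

end Bott
end

section
/- Let φ : R_A → R_B be a graded ring isomorphism that is k-stable, let ℓ := ht(φ(x_{k+1})) and assume ℓ > k+1. Suppose φ(x_{k+1}) = ε(2y_ℓ − β̄_ℓ) + w with ε ∈ ℚ nonzero and w ∈ F_k(B) ⊗ ℚ, where β̄_ℓ := Σ_{j=k+1}^{ℓ−1} b_{ℓ j} y_j. Set u := (φ(α_{k+1}) − 2w)/ε ∈ F_k(B) ⊗ ℚ. Then: (i) β_ℓ = β̄_ℓ + u/2 in H²(B) ⊗ ℚ (equivalently, Σ_{j=1}^{k} b_{ℓ j} y_j = u/2), and (ii) β̄_ℓ (β̄_ℓ + u) = 0 in R_B ⊗ ℚ. -/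
open MvPolynomial

namespace Bott

section Helpers

variable {n : ℕ}

theorem balQ_eq_sum (b : Mat n) (i : Fin n) :
    balQ n b i = ∑ j, (b i j : ℚ) • bxQ n b j := by
  simp only [balQ, alphaQ, map_sum]
  refine Finset.sum_congr rfl fun j _ => ?_
  rw [← MvPolynomial.smul_eq_C_mul]
  rfl

theorem bxQ_sq (b : Mat n) (i : Fin n) : bxQ n b i ^ 2 = balQ n b i * bxQ n b i := by
  rw [bxQ, balQ, ← map_pow, ← map_mul, ← sub_eq_zero, ← map_sub]
  exact Ideal.Quotient.eq_zero_iff_mem.mpr (Ideal.subset_span ⟨i, rfl⟩)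

theorem bx_sq_s10 (b : Mat n) (i : Fin n) : bx n b i ^ 2 = bal n b i * bx n b i := by
  rw [bx, bal, ← map_pow, ← map_mul, ← sub_eq_zero, ← map_sub]
  exact Ideal.Quotient.eq_zero_iff_mem.mpr (Ideal.subset_span ⟨i, rfl⟩)

theorem bal_eq_sum (b : Mat n) (i : Fin n) :
    bal n b i = ∑ j, b i j • bx n b j := by
  simp only [bal, alpha, map_sum]
  refine Finset.sum_congr rfl fun j _ => ?_
  rw [← MvPolynomial.smul_eq_C_mul]
  rfl

theorem toQ_bx (b : Mat n) (i : Fin n) : toQ n b (bx n b i) = bxQ n b i := by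
  have : toQ n b (bx n b i) = bmkQ n b (MvPolynomial.map (Int.castRingHom ℚ) (X i)) := rfl
  rw [this, MvPolynomial.map_X, bxQ]

theorem bal_mem_F (b : Mat n) (hb : SLT b) (i : Fin n) : bal n b i ∈ F n b i := by
  rw [bal_eq_sum]
  refine Submodule.sum_mem _ fun j _ => ?_
  by_cases h : b i j = 0
  · simp [h]
  · exact Submodule.smul_mem _ _ (Submodule.subset_span ⟨j, hb i j h, rfl⟩)

theorem toQ_mem (b : Mat n) (k : ℕ) (z : BRing n b) (hz : z ∈ F n b k) :
    toQ n b z ∈ FQ n b k := by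
  induction hz using Submodule.span_induction with
  | mem x hx =>
    obtain ⟨i, hi, rfl⟩ := hx
    rw [toQ_bx]
    exact Submodule.subset_span ⟨i, hi, rfl⟩
  | zero => simp
  | add x y _ _ h1 h2 => rw [map_add]; exact add_mem h1 h2
  | smul c x _ h => rw [map_zsmul]; exact zsmul_mem h c

/-- Universal property of the rational Bott ring. -/
theorem exists_lift (b : Mat n) {S : Type*} [CommRing S] [Algebra ℚ S] (f : Fin n → S)
    (h : ∀ i, f i ^ 2 = (∑ j, (b i j : ℚ) • f j) * f i) :
    ∃ g : BRingQ n b →ₐ[ℚ] S, ∀ i, g (bxQ n b i) = f i := by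
  have hI : ∀ p ∈ bottIdealQ n b, MvPolynomial.aeval (R := ℚ) f p = 0 := by
    have : bottIdealQ n b ≤ RingHom.ker (MvPolynomial.aeval (R := ℚ) f) := by
      rw [bottIdealQ, Ideal.span_le]
      rintro _ ⟨i, rfl⟩
      simp only [SetLike.mem_coe, RingHom.mem_ker, map_sub, map_mul, map_pow, aeval_X, alphaQ,
        map_sum, aeval_C, ← Algebra.smul_def]
      rw [h i, sub_self]
    exact fun p hp => this hp
  refine ⟨Ideal.Quotient.liftₐ (bottIdealQ n b) (MvPolynomial.aeval f) hI, fun i => ?_⟩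
  have : (Ideal.Quotient.liftₐ (bottIdealQ n b) (MvPolynomial.aeval f) hI) (bxQ n b i)
      = MvPolynomial.aeval (R := ℚ) f (X i) := rfl
  rw [this, aeval_X]

theorem lift_eq_on (b : Mat n) {S : Type*} [CommRing S] [Algebra ℚ S]
    (g g' : BRingQ n b →ₐ[ℚ] S) (k : ℕ)
    (h : ∀ i : Fin n, (i : ℕ) < k → g (bxQ n b i) = g' (bxQ n b i))
    (z : BRingQ n b) (hz : z ∈ FQ n b k) : g z = g' z := by
  induction hz using Submodule.span_induction with
  | mem x hx => obtain ⟨i, hi, rfl⟩ := hx; exact h i hi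
  | zero => simp
  | add x y _ _ h1 h2 => rw [map_add, map_add, h1, h2]
  | smul c x _ h => rw [map_smul, map_smul, h]

/-- The projection onto the first `k` generators. -/
theorem exists_proj (b : Mat n) (hb : SLT b) (k : ℕ) :
    ∃ g : BRingQ n b →ₐ[ℚ] BRingQ n b,
      ∀ i, g (bxQ n b i) = if (i : ℕ) < k then bxQ n b i else 0 := by
  refine exists_lift b _ fun i => ?_
  split_ifs with hi
  · rw [bxQ_sq, balQ_eq_sum]
    congr 1
    refine Finset.sum_congr rfl fun j _ => ?_
    by_cases h : b i j = 0
    · simp [h]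
    · rw [if_pos ((hb i j h).trans hi)]
  · simp

theorem FQ_mono (b : Mat n) {k m : ℕ} (h : k ≤ m) : FQ n b k ≤ FQ n b m :=
  Submodule.span_mono (Set.image_mono fun _ hi => lt_of_lt_of_le hi h)

theorem dvd_linear {S : Type*} [CommRing S] (β c c' : S)
    (h : (Polynomial.X ^ 2 - Polynomial.C β * Polynomial.X : Polynomial S) ∣
      Polynomial.C c * Polynomial.X + Polynomial.C c') : c = 0 := by
  rcases subsingleton_or_nontrivial S with hS | hS
  · exact Subsingleton.elim _ _
  have hq : (Polynomial.C β * Polynomial.X).degree < ((2 : ℕ) : WithBot ℕ) :=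
    lt_of_le_of_lt (Polynomial.degree_C_mul_X_le _) (by norm_num)
  have hm : (Polynomial.X ^ 2 - Polynomial.C β * Polynomial.X).Monic :=
    Polynomial.monic_X_pow_sub hq
  have hd : (Polynomial.X ^ 2 - Polynomial.C β * Polynomial.X).degree
      = ((2 : ℕ) : WithBot ℕ) := by
    rw [Polynomial.degree_sub_eq_left_of_degree_lt] <;> rw [Polynomial.degree_X_pow]
    exact hq
  by_contra hc
  refine hm.not_dvd_of_degree_lt (fun h0 => hc ?_) ?_ h
  · have := congrArg (fun q => Polynomial.coeff q 1) h0
    simpa using this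
  · rw [hd]
    exact lt_of_le_of_lt Polynomial.degree_linear_le (by norm_num)

/-- Linear independence of `1, y_ℓ` over the subring generated by the previous ones. -/
theorem coeff_zero (b : Mat n) (hb : SLT b) (l : Fin n) :
    ∃ (T : Type) (_ : CommRing T) (_ : Algebra ℚ T) (i g : BRingQ n b →ₐ[ℚ] T),
      (∀ z ∈ FQ n b l, g z = i z) ∧
      ∀ c c', i c * g (bxQ n b l) + i c' = 0 → c = 0 := by
  let S := BRingQ n b
  let p : Polynomial S := Polynomial.X ^ 2 - Polynomial.C (balQ n b l) * Polynomial.X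
  let ι : BRingQ n b →ₐ[ℚ] AdjoinRoot p := IsScalarTower.toAlgHom ℚ S (AdjoinRoot p)
  have hι : ∀ z, ι z = AdjoinRoot.mk p (Polynomial.C z) := fun z => rfl
  obtain ⟨g, hg⟩ := exists_lift b (S := AdjoinRoot p)
    (fun i => if i < l then ι (bxQ n b i) else if i = l then AdjoinRoot.root p else 0) (by
      have key : ∀ i, i ≤ l → (∑ j, (b i j : ℚ) • (if j < l then ι (bxQ n b j) else
          if j = l then AdjoinRoot.root p else 0)) = ι (balQ n b i) := by
        intro i hi
        rw [balQ_eq_sum, map_sum]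
        refine Finset.sum_congr rfl fun j _ => ?_
        rw [map_smul]
        by_cases h : b i j = 0
        · simp [h]
        · rw [if_pos (lt_of_lt_of_le (Fin.lt_def.2 (hb i j h)) hi)]
      intro i
      rcases lt_trichotomy i l with hi | hi | hi
      · rw [key i hi.le, if_pos hi, ← map_pow, ← map_mul, bxQ_sq]
      · rw [key i hi.le, if_neg (by simp [hi]), if_pos hi, hι, hi, ← AdjoinRoot.mk_X,
          ← map_pow, ← map_mul, ← sub_eq_zero, ← map_sub]
        exact AdjoinRoot.mk_self
      · rw [if_neg hi.not_gt, if_neg hi.ne']; simp)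
  refine ⟨AdjoinRoot p, inferInstance, inferInstance, ι, g, ?_, ?_⟩
  · exact lift_eq_on b g ι l fun i hi => by rw [hg, if_pos (Fin.lt_def.2 hi)]
  · intro c c' h
    rw [hg, if_neg (lt_irrefl _), if_pos rfl, hι, hι, ← AdjoinRoot.mk_X, ← map_mul, ← map_add,
      AdjoinRoot.mk_eq_zero] at h
    exact dvd_linear _ _ _ h

theorem core (b : Mat n) (hb : SLT b) (k : ℕ) (l : Fin n) (hkl : k < l)
    (ε : ℚ) (hε : ε ≠ 0) (w t x : BRingQ n b) (hw : w ∈ FQ n b k) (ht : t ∈ FQ n b k)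
    (hx : x = ε • (2 * bxQ n b l - bbarQ n b k l) + w) (hxx : x ^ 2 = t * x) :
    balQ n b l = bbarQ n b k l + (2 : ℚ)⁻¹ • (ε⁻¹ • (t - 2 • w)) ∧
    bbarQ n b k l * (bbarQ n b k l + ε⁻¹ • (t - 2 • w)) = 0 := by
  set u := ε⁻¹ • (t - 2 • w) with hu
  have huF : u ∈ FQ n b k := Submodule.smul_mem _ _ (sub_mem ht (nsmul_mem hw 2))
  have htu : t = ε • u + 2 * w := by
    rw [hu, smul_inv_smul₀ hε, two_nsmul]; ring
  have hγF : balQ n b l - bbarQ n b k l ∈ FQ n b k := by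
    have : balQ n b l = bbarQ n b k l +
        ∑ j ∈ Finset.univ.filter (fun j : Fin n => ¬ (k ≤ (j : ℕ) ∧ j < l)),
          (b l j : ℚ) • bxQ n b j := by
      rw [balQ_eq_sum, bbarQ, Finset.sum_filter_add_sum_filter_not]
    rw [this, add_sub_cancel_left]
    refine Submodule.sum_mem _ fun j hj => ?_
    by_cases h : b l j = 0
    · simp [h]
    · refine Submodule.smul_mem _ _ (Submodule.subset_span ⟨j, ?_, rfl⟩)
      have h1 := hb l j h
      simp only [Finset.mem_filter, Finset.mem_univ, true_and, Fin.lt_def] at hj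
      show (j : ℕ) < k
      omega
  have hβF : bbarQ n b k l ∈ FQ n b l := by
    refine Submodule.sum_mem _ fun j hj => ?_
    simp only [Finset.mem_filter, Finset.mem_univ, true_and] at hj
    exact Submodule.smul_mem _ _ (Submodule.subset_span ⟨j, hj.2, rfl⟩)
  set γ := balQ n b l - bbarQ n b k l with hγ
  set β := bbarQ n b k l with hβ
  set y := bxQ n b l with hy
  set e : BRingQ n b := algebraMap ℚ _ ε with he
  have hy2 : y ^ 2 = (γ + β) * y := by rw [hγ, sub_add_cancel]; exact bxQ_sq b l
  have sm : ∀ (q : ℚ) (z : BRingQ n b), q • z = algebraMap ℚ (BRingQ n b) q * z :=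
    fun q z => Algebra.smul_def q z
  rw [sm] at hx htu
  rw [← he] at hx htu
  have hee : (algebraMap ℚ (BRingQ n b) ε⁻¹) * e = 1 := by
    rw [he, ← map_mul, inv_mul_cancel₀ hε, map_one]
  have main : (e ^ 2 * (4 * γ - 2 * u)) * y + (e ^ 2 * (β * (β + u)) - w * (w + e * u)) = 0 := by
    rw [hx, htu] at hxx
    linear_combination hxx - 4 * e ^ 2 * hy2
  have hc : e ^ 2 * (4 * γ - 2 * u) = 0 := by
    obtain ⟨T, _, _, i, g, hig, hz⟩ := coeff_zero b hb l
    apply hz _ (e ^ 2 * (β * (β + u)) - w * (w + e * u))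
    have hm := congrArg g main
    have m := FQ_mono b hkl.le
    simp only [map_add, map_mul, map_sub, map_pow, map_zero, map_ofNat, he,
      AlgHom.commutes, hig _ (m huF), hig _ (m hγF), hig _ (m hw), hig _ hβF] at hm ⊢
    exact hm
  have hγu : 4 * γ - 2 * u = 0 := by
    linear_combination (algebraMap ℚ (BRingQ n b) ε⁻¹) ^ 2 * hc
      - (4 * γ - 2 * u) * ((algebraMap ℚ (BRingQ n b) ε⁻¹) * e + 1) * hee
  rw [hc, zero_mul, zero_add] at main
  constructor
  · have h4 : (4 : ℚ) • γ = (4 : ℚ) • ((2 : ℚ)⁻¹ • u) := by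
      rw [smul_smul, sm, sm]
      norm_num only
      rw [map_ofNat, map_ofNat]
      linear_combination hγu
    have := smul_right_injective (R := ℚ) (BRingQ n b) (by norm_num : (4 : ℚ) ≠ 0) h4
    rw [← this, hγ]; ring
  · obtain ⟨g, hg⟩ := exists_proj b hb k
    have hid : ∀ z ∈ FQ n b k, g z = z := fun z hz =>
      lift_eq_on b g (AlgHom.id ℚ _) k (fun i hi => by rw [hg, if_pos hi]; rfl) z hz
    have hg0 : g β = 0 := by
      rw [hβ, bbarQ, map_sum]
      refine Finset.sum_eq_zero fun j hj => ?_
      simp only [Finset.mem_filter, Finset.mem_univ, true_and] at hj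
      rw [map_smul, hg, if_neg (not_lt.2 hj.1), smul_zero]
    have hm := congrArg g main
    simp only [map_add, map_mul, map_sub, map_pow, map_zero, he, AlgHom.commutes,
      hid _ huF, hid _ hw, hg0] at hm
    rw [← he] at hm
    linear_combination (algebraMap ℚ (BRingQ n b) ε⁻¹) ^ 2 * (main - hm)
      - (β * (β + u)) * ((algebraMap ℚ (BRingQ n b) ε⁻¹) * e + 1) * hee

end Helpers

/-- Let `φ : R_A → R_B` be a `k`-stable graded ring isomorphism,
`ℓ := ht(φ(x_{k+1})) > k + 1`, and suppose `φ(x_{k+1}) = ε(2y_ℓ − β̄_ℓ) + w` with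
`ε ∈ ℚ` nonzero and `w ∈ F_k(B) ⊗ ℚ`.  With `u := (φ(α_{k+1}) − 2w)/ε` we have:
(i) `β_ℓ = β̄_ℓ + u/2` in `H²(B) ⊗ ℚ`, and (ii) `β̄_ℓ(β̄_ℓ + u) = 0` in `R_B ⊗ ℚ`. -/
theorem stmt_10 (n k : ℕ) (hk : k < n) (a b : Mat n) (ha : SLT a) (hb : SLT b)
    (φ : BRing n a ≃+* BRing n b) (hφ : IsGraded n a b φ) (hst : IsStable n a b k φ)
    (l : ℕ) (hl : l = ht n b (φ (bx n a ⟨k, hk⟩))) (hlk : k + 1 < l) (hln : l ≤ n)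
    (ε : ℚ) (hε : ε ≠ 0) (w : BRingQ n b) (hw : w ∈ FQ n b k)
    (hrep : toQ n b (φ (bx n a ⟨k, hk⟩)) =
      ε • (2 * bxQ n b ⟨l - 1, by omega⟩ - bbarQ n b k ⟨l - 1, by omega⟩) + w) :
    balQ n b ⟨l - 1, by omega⟩ =
        bbarQ n b k ⟨l - 1, by omega⟩ +
          (2 : ℚ)⁻¹ • (ε⁻¹ • (toQ n b (φ (bal n a ⟨k, hk⟩)) - 2 • w)) ∧
    bbarQ n b k ⟨l - 1, by omega⟩ *
        (bbarQ n b k ⟨l - 1, by omega⟩ +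
          ε⁻¹ • (toQ n b (φ (bal n a ⟨k, hk⟩)) - 2 • w)) = 0 := by
  refine core b hb k ⟨l - 1, by omega⟩ (by show k < l - 1; omega) ε hε w _ _ hw
    (toQ_mem b k _ (hst _ (bal_mem_F a ha ⟨k, hk⟩))) hrep ?_
  rw [← map_pow, ← map_pow, bx_sq_s10, map_mul, map_mul]

end Bott
end
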